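/- Let A be a finite Taylor algebra, ρ ∈ Con(A) meet-irreducible, and τ, τ' ∈ Cov⁺(ρ). Then there exists a reflexive bridge from (A,ρ,τ) to (A,ρ,τ'); consequently Opt(ρ,τ) = Opt(ρ,τ'). -/

import Mathlib

namespace Zhuk

/-- A signature: a type of operation symbols with arities. -/
structure Signature where
  ops : Type
  arity : ops → ℕ

/-- An algebra structure of signature `S` on carrier `A`. -/
class SAlg (S : Signature) (A : Type) where
  interp : (o : S.ops) → (Fin (S.arity o) → A) → A

variable {S : Signature}

/-- Componentwise algebra structure on a product. -/
instance prodSAlg {A B : Type} [SAlg S A] [SAlg S B] : SAlg S (A × B) :=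
  ⟨fun o x => (SAlg.interp o fun i => (x i).1, SAlg.interp o fun i => (x i).2)⟩

/-- A subset closed under all the operations. -/
def IsSubuniverse (S : Signature) {A : Type} [SAlg S A] (R : Set A) : Prop :=
  ∀ (o : S.ops) (x : Fin (S.arity o) → A), (∀ i, x i ∈ R) → SAlg.interp o x ∈ R

/-- The algebra structure on (the subtype of) a subuniverse. -/
def subAlg {A : Type} [SAlg S A] (R : Set A) (h : IsSubuniverse S R) : SAlg S ↥R :=
  ⟨fun o x => ⟨SAlg.interp o fun i => (x i).1, h o _ fun i => (x i).2⟩⟩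

/-- Terms of signature `S` in `n` variables. -/
inductive STerm (S : Signature) (n : ℕ) : Type
  | var : Fin n → STerm S n
  | app (o : S.ops) : (Fin (S.arity o) → STerm S n) → STerm S n

/-- Evaluation of a term in an algebra. -/
def STerm.eval {A : Type} [SAlg S A] {n : ℕ} : STerm S n → (Fin n → A) → A
  | .var i, v => v i
  | .app o ts, v => SAlg.interp o fun i => (ts i).eval v

/-- The diagonal (smallest) congruence `0_A`. -/
def diag (A : Type) : Set (A × A) := {p | p.1 = p.2}

/-- Relational composition. -/
def rcomp {A B C : Type} (R : Set (A × B)) (T : Set (B × C)) : Set (A × C) :=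
  {p | ∃ b, (p.1, b) ∈ R ∧ (b, p.2) ∈ T}

/-- Relational inverse. -/
def rinv {A B : Type} (R : Set (A × B)) : Set (B × A) := {p | (p.2, p.1) ∈ R}

/-- Transitive closure of a binary relation (as a set of pairs). -/
def transCl {A : Type} (R : Set (A × A)) : Set (A × A) :=
  {p | Relation.TransGen (fun a b => (a, b) ∈ R) p.1 p.2}

/-- `R` is stable under (saturated with respect to) `ρ`:  `R = ρ ∘ R ∘ ρ`. -/
def Saturated {A : Type} (ρ R : Set (A × A)) : Prop := rcomp ρ (rcomp R ρ) = R

/-- A congruence: a subuniverse of `A²` which is an equivalence relation. -/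
def IsCongruence (S : Signature) {A : Type} [SAlg S A] (θ : Set (A × A)) : Prop :=
  IsSubuniverse S θ ∧ Equivalence fun a b => (a, b) ∈ θ

/-- `ρ ∈ Con*(A)`: a congruence different from the full congruence `1_A`. -/
def ConStar (S : Signature) {A : Type} [SAlg S A] (ρ : Set (A × A)) : Prop :=
  IsCongruence S ρ ∧ ρ ≠ Set.univ

/-- The ternary centralizer relation `C(φ, θ; δ)`, via the term condition. -/
def Centralizes (S : Signature) {A : Type} [SAlg S A] (φ θ δ : Set (A × A)) : Prop :=
  ∀ (n : ℕ) (t : STerm S (n + 1)) (a b : A) (c d : Fin n → A),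
    (a, b) ∈ φ → (∀ i, (c i, d i) ∈ θ) →
    (t.eval (Fin.cons a c), t.eval (Fin.cons a d)) ∈ δ →
    (t.eval (Fin.cons b c), t.eval (Fin.cons b d)) ∈ δ

/-- The centralizer `(δ : θ)`: the largest congruence `φ` with `C(φ, θ; δ)`. -/
def centralizer (S : Signature) {A : Type} [SAlg S A] (δ θ : Set (A × A)) : Set (A × A) :=
  ⋃₀ {φ | IsCongruence S φ ∧ Centralizes S φ θ δ}

/-- A congruence of the subalgebra `A(θ) ≤ A²`, viewed ambiently as a subset of
`(A×A) × (A×A)` whose field is `θ`. -/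
def IsConOn (S : Signature) {A : Type} [SAlg S A] (θ : Set (A × A))
    (Δ : Set ((A × A) × (A × A))) : Prop :=
  Δ ⊆ θ ×ˢ θ ∧ IsSubuniverse S Δ ∧ (∀ p ∈ θ, (p, p) ∈ Δ) ∧
    (∀ p q, (p, q) ∈ Δ → (q, p) ∈ Δ) ∧ (∀ p q r, (p, q) ∈ Δ → (q, r) ∈ Δ → (p, r) ∈ Δ)

/-- `Δ_{θ,α}`: the congruence of `A(θ)` generated by `{((a,a),(b,b)) : (a,b) ∈ α}`. -/
def DeltaCon (S : Signature) {A : Type} [SAlg S A] (θ α : Set (A × A)) :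
    Set ((A × A) × (A × A)) :=
  ⋂₀ {Δ | IsConOn S θ Δ ∧ ∀ a b : A, (a, b) ∈ α → ((a, a), (b, b)) ∈ Δ}

/-- Projection of a quaternary relation to its first two coordinates. -/
def pr12 {A B : Type} (T : Set (A × A × B × B)) : Set (A × A) :=
  {p | ∃ b₁ b₂, (p.1, p.2, b₁, b₂) ∈ T}

/-- Projection of a quaternary relation to its last two coordinates. -/
def pr34 {A B : Type} (T : Set (A × A × B × B)) : Set (B × B) :=
  {q | ∃ a₁ a₂, (a₁, a₂, q.1, q.2) ∈ T}

/-- The trace of a quaternary relation. -/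
def btr {A B : Type} (T : Set (A × A × B × B)) : Set (A × B) :=
  {p | (p.1, p.1, p.2, p.2) ∈ T}

/-- Zhuk's bridges: Definition 4.3 (B0*), (B1*), (B2*). -/
def IsBridge (S : Signature) {A B : Type} [SAlg S A] [SAlg S B]
    (ρ : Set (A × A)) (σ : Set (B × B)) (T : Set (A × A × B × B)) : Prop :=
  IsSubuniverse S T ∧
  (∀ a₁ a₂ b₁ b₂ a₁' a₂', (a₁, a₂, b₁, b₂) ∈ T → (a₁, a₁') ∈ ρ → (a₂, a₂') ∈ ρ →
    (a₁', a₂', b₁, b₂) ∈ T) ∧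
  (∀ a₁ a₂ b₁ b₂ b₁' b₂', (a₁, a₂, b₁, b₂) ∈ T → (b₁, b₁') ∈ σ → (b₂, b₂') ∈ σ →
    (a₁, a₂, b₁', b₂') ∈ T) ∧
  ρ ⊂ pr12 T ∧ σ ⊂ pr34 T ∧
  (∀ a₁ a₂ b₁ b₂, (a₁, a₂, b₁, b₂) ∈ T → ((a₁, a₂) ∈ ρ ↔ (b₁, b₂) ∈ σ))

/-- A bridge from `(A,ρ,L)` to `(B,σ,R)`: a bridge with prescribed anchors. -/
def IsBridgeLR (S : Signature) {A B : Type} [SAlg S A] [SAlg S B]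
    (ρ : Set (A × A)) (σ : Set (B × B)) (L : Set (A × A)) (R : Set (B × B))
    (T : Set (A × A × B × B)) : Prop :=
  IsBridge S ρ σ T ∧ pr12 T = L ∧ pr34 T = R

/-- A reflexive bridge (case `B = A`): `0_A ⊆ tr(T)`. -/
def ReflBridge {A : Type} (T : Set (A × A × A × A)) : Prop :=
  ∀ a : A, (a, a) ∈ btr T

/-- `Cov(ρ)`: the inclusion-minimal ρ-saturated subuniverses of `A²` properly containing ρ. -/
def Cov (S : Signature) {A : Type} [SAlg S A] (ρ : Set (A × A)) : Set (Set (A × A)) :=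
  {L | IsSubuniverse S L ∧ Saturated ρ L ∧ ρ ⊂ L ∧
    ∀ L', IsSubuniverse S L' → Saturated ρ L' → ρ ⊂ L' → L' ⊆ L → L' = L}

/-- `ref.tr(ρ,L)`: traces of reflexive bridges from `(A,ρ,L)` to itself. -/
def refTr (S : Signature) {A : Type} [SAlg S A] (ρ L : Set (A × A)) : Set (Set (A × A)) :=
  {γ | ∃ T : Set (A × A × A × A), IsBridgeLR S ρ ρ L L T ∧ ReflBridge T ∧ btr T = γ}

/-- `γ = Opt(ρ,L)`: `γ` is the (unique) inclusion-maximal member of `ref.tr(ρ,L)`. -/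
def IsOptOf (S : Signature) {A : Type} [SAlg S A] (ρ L γ : Set (A × A)) : Prop :=
  γ ∈ refTr S ρ L ∧ ∀ δ ∈ refTr S ρ L, γ ⊆ δ → δ = γ

/-- `ρ` is meet-irreducible with unique upper cover `ρplus`. -/
def MeetIrredWith (S : Signature) {A : Type} [SAlg S A] (ρ ρplus : Set (A × A)) : Prop :=
  IsCongruence S ρ ∧ ρ ≠ Set.univ ∧ IsCongruence S ρplus ∧ ρ ⊂ ρplus ∧
    ∀ θ, IsCongruence S θ → ρ ⊂ θ → ρplus ⊆ θ

/-- `Cov⁺(ρ) = {τ ∈ Cov(ρ) : τ ⊆ ρ⁺}`. -/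
def CovPlus (S : Signature) {A : Type} [SAlg S A] (ρ ρplus : Set (A × A)) :
    Set (Set (A × A)) :=
  {τ | τ ∈ Cov S ρ ∧ τ ⊆ ρplus}

/-- A good bridge between meet-irreducible congruences with upper covers `ρplus`, `σplus`. -/
def GoodBridge (S : Signature) {A B : Type} [SAlg S A] [SAlg S B]
    (ρ ρplus : Set (A × A)) (σ σplus : Set (B × B)) (T : Set (A × A × B × B)) : Prop :=
  IsBridge S ρ σ T ∧
    ∃ τ ∈ CovPlus S ρ ρplus, ∃ τ' ∈ CovPlus S σ σplus, ∃ T' ⊆ T,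
      IsBridgeLR S ρ σ τ τ' T' ∧ btr T' = btr T

/-- `t` (with Taylor-identity data `u v`) is idempotent on `A` and satisfies the
corresponding identities on `A`. -/
def TaylorOn (S : Signature) (A : Type) [SAlg S A] {n : ℕ} (t : STerm S n)
    (u v : Fin n → Fin n → Fin 2) : Prop :=
  (∀ a : A, t.eval (fun _ => a) = a) ∧
    ∀ (i : Fin n) (x y : A),
      t.eval (fun j => if u i j = 0 then x else y) =
        t.eval (fun j => if v i j = 0 then x else y)

/-- `A` is a Taylor algebra. -/
def IsTaylorAlg (S : Signature) (A : Type) [SAlg S A] : Prop :=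
  ∃ (n : ℕ) (t : STerm S n) (u v : Fin n → Fin n → Fin 2),
    1 < n ∧ (∀ i, u i i ≠ v i i) ∧ TaylorOn S A t u v

/-- `A` and `B` lie in a common (locally finite, as they are finite) Taylor variety:
they share a common Taylor term with common Taylor identities. -/
def CommonTaylor (S : Signature) (A B : Type) [SAlg S A] [SAlg S B] : Prop :=
  ∃ (n : ℕ) (t : STerm S n) (u v : Fin n → Fin n → Fin 2),
    1 < n ∧ (∀ i, u i i ≠ v i i) ∧ TaylorOn S A t u v ∧ TaylorOn S B t u v

/-- The quotient of `A` by (the equivalence relation of) `θ`. -/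
abbrev ConQuot {A : Type} (θ : Set (A × A)) : Type :=
  Quot (fun a b => (a, b) ∈ θ)

/-- The class of `a` in `A/θ`. -/
def ConQuot.mk {A : Type} (θ : Set (A × A)) (a : A) : ConQuot θ :=
  Quot.mk _ a

/-- The quotient algebra structure on `A/θ` (extensionally correct when `θ` is a
congruence). -/
noncomputable def quotAlg {S : Signature} {A : Type} (iA : SAlg S A) (θ : Set (A × A)) :
    SAlg S (ConQuot θ) :=
  ⟨fun o x => ConQuot.mk θ
    (@SAlg.interp S A iA o fun i => Classical.choose (Quot.exists_rep (x i)))⟩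

/-- `f` is a homomorphism with respect to the given algebra structures. -/
def IsHomI {S : Signature} {A B : Type} (iA : SAlg S A) (iB : SAlg S B) (f : A → B) : Prop :=
  ∀ (o : S.ops) (x : Fin (S.arity o) → A),
    f (@SAlg.interp S A iA o x) = @SAlg.interp S B iB o fun i => f (x i)

/-- The two algebras are isomorphic. -/
def IsoAlgI {S : Signature} {A B : Type} (iA : SAlg S A) (iB : SAlg S B) : Prop :=
  ∃ f : A ≃ B, IsHomI iA iB f

/-- The identity bridge `I_{(A,ρ,L)}`. -/
def idBridge {A : Type} (ρ L : Set (A × A)) : Set (A × A × A × A) :=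
  {p | (p.1, p.2.1) ∈ L ∧ (p.2.2.1, p.2.2.2) ∈ L ∧ (p.1, p.2.2.1) ∈ ρ ∧ (p.2.1, p.2.2.2) ∈ ρ}

/-- Composition of quaternary relations (bridges). -/
def bComp {A B C : Type} (T : Set (A × A × B × B)) (T' : Set (B × B × C × C)) :
    Set (A × A × C × C) :=
  {p | ∃ b₁ b₂, (p.1, p.2.1, b₁, b₂) ∈ T ∧ (b₁, b₂, p.2.2.1, p.2.2.2) ∈ T'}

/-- Converse of a quaternary relation (bridge). -/
def bConv {A B : Type} (T : Set (A × A × B × B)) : Set (B × B × A × A) :=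
  {p | (p.2.2.1, p.2.2.2, p.1, p.2.1) ∈ T}

/-- `Δ♭_{θ,α}`: the congruence `Δ_{θ,α}` of `A(θ)` viewed as a quaternary relation. -/
def deltaFlat (S : Signature) {A : Type} [SAlg S A] (θ α : Set (A × A)) :
    Set (A × A × A × A) :=
  {p | ((p.1, p.2.1), (p.2.2.1, p.2.2.2)) ∈ DeltaCon S θ α}

/-- `T^opt_{(A,ρ)} = I_{(A,ρ,ρ⁺)} ∘ Δ♭_{ρ⁺,(ρ:ρ⁺)} ∘ I_{(A,ρ,ρ⁺)}`. -/
def Topt (S : Signature) {A : Type} [SAlg S A] (ρ ρplus : Set (A × A)) :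
    Set (A × A × A × A) :=
  bComp (idBridge ρ ρplus)
    (bComp (deltaFlat S ρplus (centralizer S ρ ρplus)) (idBridge ρ ρplus))

/-- `A` is subdirectly irreducible with monolith `μ`. -/
def IsMonolith (S : Signature) {A : Type} [SAlg S A] (μ : Set (A × A)) : Prop :=
  IsCongruence S μ ∧ μ ≠ diag A ∧ ∀ θ, IsCongruence S θ → θ ≠ diag A → μ ⊆ θ

/-- The carrier of `D(A,θ)`-style quotients: `A(μ)/Δ_{μ,α}`. -/
abbrev DCar (S : Signature) (A : Type) [SAlg S A] (μ α : Set (A × A)) : Type :=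
  Quot (fun p q : ↥μ => ((p : A × A), (q : A × A)) ∈ DeltaCon S μ α)

/-- The class of a pair `p ∈ μ` in `A(μ)/Δ_{μ,α}`. -/
def DCar.mk (S : Signature) (A : Type) [SAlg S A] (μ α : Set (A × A)) (p : ↥μ) :
    DCar S A μ α :=
  Quot.mk _ p

/-- The algebra structure on `A(μ)/Δ_{μ,α}` (extensionally correct when `μ` is a
congruence and `Δ_{μ,α}` is a congruence of `A(μ)`). -/
noncomputable def DAlg (S : Signature) (A : Type) [SAlg S A] (μ α : Set (A × A))
    (h : IsSubuniverse S μ) : SAlg S (DCar S A μ α) :=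
  letI := subAlg μ h
  ⟨fun o x => DCar.mk S A μ α
    (SAlg.interp o fun i => Classical.choose (Quot.exists_rep (x i)))⟩

/-- The canonical similarity bridge `T_{D(A)}` from `A` to `D(A)`. -/
def TDBridge (S : Signature) (A : Type) [SAlg S A] (μ α : Set (A × A)) :
    Set (A × A × DCar S A μ α × DCar S A μ α) :=
  {x | ∃ (a b e : A) (_ : (a, b) ∈ μ) (h1 : (a, e) ∈ μ) (h2 : (b, e) ∈ μ),
    x = (a, b, DCar.mk S A μ α ⟨(a, e), h1⟩, DCar.mk S A μ α ⟨(b, e), h2⟩)}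

/-- Similarity of (subdirectly irreducible) algebras: `D(A) ≅ D(B)`, where `D(X)` is
`X(μ)/Δ_{μ,(0:μ)}` if the monolith `μ` is abelian, and `X` itself otherwise. -/
def SimilarI (S : Signature) {A B : Type} (iA : SAlg S A) (iB : SAlg S B) : Prop :=
  letI := iA
  letI := iB
  ∃ (μA : Set (A × A)) (μB : Set (B × B)) (hA : IsMonolith S μA) (hB : IsMonolith S μB),
    ((Centralizes S μA μA (diag A) ∧ Centralizes S μB μB (diag B)) →
      IsoAlgI (DAlg S A μA (centralizer S (diag A) μA) hA.1.1)
        (DAlg S B μB (centralizer S (diag B) μB) hB.1.1)) ∧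
    ((Centralizes S μA μA (diag A) ∧ ¬ Centralizes S μB μB (diag B)) →
      IsoAlgI (DAlg S A μA (centralizer S (diag A) μA) hA.1.1) iB) ∧
    ((¬ Centralizes S μA μA (diag A) ∧ Centralizes S μB μB (diag B)) →
      IsoAlgI iA (DAlg S B μB (centralizer S (diag B) μB) hB.1.1)) ∧
    ((¬ Centralizes S μA μA (diag A) ∧ ¬ Centralizes S μB μB (diag B)) →
      IsoAlgI iA iB)

end Zhuk

namespace Zhuk

/-- Unary polynomial operations of an algebra. -/
inductive UnaryPoly (S : Signature) {A : Type} [SAlg S A] : (A → A) → Prop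
  | id : UnaryPoly S fun x => x
  | const (a : A) : UnaryPoly S fun _ => a
  | app (o : S.ops) (f : Fin (S.arity o) → A → A) (hf : ∀ i, UnaryPoly S (f i)) :
      UnaryPoly S fun x => SAlg.interp o fun i => f i x

namespace UnaryPoly

variable {A : Type} [SAlg S A]

theorem comp {p q : A → A} (hp : UnaryPoly S p) (hq : UnaryPoly S q) :
    UnaryPoly S fun x => p (q x) := by
  induction hp with
  | id => exact hq
  | const a => exact const a
  | app o f _ ih => exact app o (fun i x => f i (q x)) ih

theorem interp_update (o : S.ops) (w : Fin (S.arity o) → A) (i : Fin (S.arity o)) :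
    UnaryPoly S fun z => SAlg.interp o (Function.update w i z) := by
  refine app o (fun j z => Function.update w i z j) fun j => ?_
  by_cases h : j = i
  · subst h
    simpa using id
  · simpa [h] using const (w j)

theorem mem_of_reflexive {p : A → A} (hp : UnaryPoly S p) {R : Set (A × A)}
    (hR : IsSubuniverse S R) (hrefl : ∀ a, (a, a) ∈ R) {a b : A} (hab : (a, b) ∈ R) :
    (p a, p b) ∈ R := by
  induction hp with
  | id => exact hab
  | const c => exact hrefl c
  | app o f _ ih => exact hR o (fun i => (f i a, f i b)) ih

end UnaryPoly

section

variable {A : Type} [SAlg S A]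

/-- An equivalence relation preserved by all unary polynomials is a congruence. -/
theorem isCongruence_of_unaryPoly {θ : Set (A × A)} (hθ : Equivalence fun a b => (a, b) ∈ θ)
    (h : ∀ p : A → A, UnaryPoly S p → ∀ a b, (a, b) ∈ θ → (p a, p b) ∈ θ) :
    IsCongruence S θ := by
  classical
  refine ⟨fun o x hx => ?_, hθ⟩
  have key : ∀ s : Finset (Fin (S.arity o)),
      (SAlg.interp o (fun i => (x i).1),
        SAlg.interp o (s.piecewise (fun i => (x i).2) (fun i => (x i).1))) ∈ θ := by
    intro s
    induction s using Finset.induction_on with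
    | empty => simpa using hθ.refl _
    | insert i s hi ih =>
      refine hθ.trans ih ?_
      have hstep := h _ (UnaryPoly.interp_update o
        (s.piecewise (fun i => (x i).2) (fun i => (x i).1)) i) _ _ (hx i)
      rw [Finset.piecewise_insert]
      convert hstep using 3
      rw [eq_comm, Function.update_eq_self_iff]
      simp [hi]
  have hall := key Finset.univ
  rw [Finset.piecewise_univ] at hall
  exact hall

theorem diag_mem_of_isCongruence_ssubset {ρ τ : Set (A × A)} (hρ : IsCongruence S ρ)
    (h : ρ ⊂ τ) (a : A) : (a, a) ∈ τ :=
  h.1 (hρ.2.refl a)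

theorem Saturated.mem {ρ τ : Set (A × A)} (h : Saturated ρ τ) {a b a' b' : A}
    (haa' : (a, a') ∈ ρ) (hab : (a', b') ∈ τ) (hbb' : (b', b) ∈ ρ) : (a, b) ∈ τ := by
  rw [← h]
  exact ⟨a', haa', b', hab, hbb'⟩

theorem saturated_of_stable {ρ τ : Set (A × A)} (hρ : IsCongruence S ρ)
    (h : ∀ a b a' b', (a, a') ∈ ρ → (a', b') ∈ τ → (b', b) ∈ ρ → (a, b) ∈ τ) :
    Saturated ρ τ := by
  apply Set.Subset.antisymm
  · rintro ⟨a, b⟩ ⟨a', h1, b', h2, h3⟩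
    exact h a b a' b' h1 h2 h3
  · rintro ⟨a, b⟩ hab
    exact ⟨a, hρ.2.refl a, b, hab, hρ.2.refl b⟩

/-- A map collapsing a cover of `ρ` modulo `ρ` collapses `ρ⁺` modulo `ρ`. -/
theorem collapses_upperCover {ρ ρplus τ : Set (A × A)} (hmi : MeetIrredWith S ρ ρplus)
    (hτ : τ ∈ Cov S ρ) {f : A → A}
    (h : ∀ a b, (a, b) ∈ τ → (f a, f b) ∈ ρ) {a b : A} (hab : (a, b) ∈ ρplus) :
    (f a, f b) ∈ ρ := by
  obtain ⟨hρ, -, -, -, hmin⟩ := hmi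
  obtain ⟨hτsub, -, hlt, -⟩ := hτ
  let θ : Set (A × A) := {x | ∀ q : A → A, UnaryPoly S q → (f (q x.1), f (q x.2)) ∈ ρ}
  have hτθ : τ ⊆ θ := fun x hx q hq =>
    h _ _ (hq.mem_of_reflexive hτsub (diag_mem_of_isCongruence_ssubset hρ hlt) hx)
  have hθ : IsCongruence S θ := isCongruence_of_unaryPoly
    ⟨fun _ _ _ => hρ.2.refl _, fun hx q hq => hρ.2.symm (hx q hq),
      fun hx hy q hq => hρ.2.trans (hx q hq) (hy q hq)⟩
    fun p hp _ _ hx q hq => hx _ (hq.comp hp)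
  exact hmin θ hθ (hlt.trans_subset hτθ) hab _ UnaryPoly.id

/-- There are pairs in `τ \ ρ` and `τ' \ ρ` collapsed modulo `ρ` by the same unary
polynomials. -/
theorem exists_equicollapsed_pairs [Finite A] {ρ ρplus τ τ' : Set (A × A)}
    (hmi : MeetIrredWith S ρ ρplus) (hτ : τ ∈ CovPlus S ρ ρplus)
    (hτ' : τ' ∈ CovPlus S ρ ρplus) :
    ∃ a b c d : A, (a, b) ∈ τ ∧ (a, b) ∉ ρ ∧ (c, d) ∈ τ' ∧ (c, d) ∉ ρ ∧
      ∀ p : A → A, UnaryPoly S p → ((p a, p b) ∈ ρ ↔ (p c, p d) ∈ ρ) := by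
  have hρ := hmi.1
  let ker : (A → A) → Set (A × A) := fun f => {x | (f x.1, f x.2) ∈ ρ}
  let F : Set (A → A) := {f | UnaryPoly S f ∧ ¬ ρplus ⊆ ker f}
  have hid : (fun x => x) ∈ F := ⟨UnaryPoly.id, fun h => hmi.2.2.2.1.2 h⟩
  obtain ⟨f, ⟨hf, hfn⟩, hmax⟩ := (Set.toFinite F).exists_maximalFor ker F ⟨_, hid⟩
  have hne : ∀ σ ∈ CovPlus S ρ ρplus, ∃ a b, (a, b) ∈ σ ∧ (f a, f b) ∉ ρ := by
    intro σ hσ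
    by_contra! h
    exact hfn fun x hx => collapses_upperCover hmi hσ.1 h hx
  have hpres : ∀ σ ∈ CovPlus S ρ ρplus, ∀ a b, (a, b) ∈ σ → (f a, f b) ∈ σ :=
    fun σ hσ a b hab => hf.mem_of_reflexive hσ.1.1
      (diag_mem_of_isCongruence_ssubset hρ hσ.1.2.2.1) hab
  have hcol : ∀ p : A → A, UnaryPoly S p → ∀ a b c d : A, (a, b) ∈ ρplus → (f c, f d) ∉ ρ →
      (p (f c), p (f d)) ∈ ρ → (p (f a), p (f b)) ∈ ρ := by
    intro p hp a b c d hab hcd hpcd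
    by_contra hpab
    have hle : ker f ⊆ ker fun x => p (f x) :=
      fun x hx => hp.mem_of_reflexive hρ.1 hρ.2.refl hx
    exact hcd (hmax ⟨hp.comp hf, fun h => hpab (h hab)⟩ hle (a := (c, d)) hpcd)
  obtain ⟨a, b, hab, hfab⟩ := hne τ hτ
  obtain ⟨c, d, hcd, hfcd⟩ := hne τ' hτ'
  exact ⟨f a, f b, f c, f d, hpres τ hτ a b hab, hfab, hpres τ' hτ' c d hcd, hfcd,
    fun p hp => ⟨hcol p hp c d a b (hτ'.2 hcd) hfab, hcol p hp a b c d (hτ.2 hab) hfcd⟩⟩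

/-- The `ρ`-saturation of the reflexive subuniverse of `A⁴` generated by `(a, b, c, d)`. -/
def polyBridge (S : Signature) {A : Type} [SAlg S A] (ρ : Set (A × A)) (a b c d : A) :
    Set (A × A × A × A) :=
  {x | ∃ p : A → A, UnaryPoly S p ∧ (p a, x.1) ∈ ρ ∧ (p b, x.2.1) ∈ ρ ∧
    (p c, x.2.2.1) ∈ ρ ∧ (p d, x.2.2.2) ∈ ρ}

theorem isSubuniverse_polyBridge {ρ : Set (A × A)} (hρ : IsCongruence S ρ) (a b c d : A) :
    IsSubuniverse S (polyBridge S ρ a b c d) := by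
  intro o x hx
  choose p hp h1 h2 h3 h4 using hx
  exact ⟨_, UnaryPoly.app o p hp, hρ.1 o (fun i => (p i a, (x i).1)) h1,
    hρ.1 o (fun i => (p i b, (x i).2.1)) h2, hρ.1 o (fun i => (p i c, (x i).2.2.1)) h3,
    hρ.1 o (fun i => (p i d, (x i).2.2.2)) h4⟩

theorem isSubuniverse_pr12 {B : Type} [SAlg S B] {T : Set (A × A × B × B)}
    (hT : IsSubuniverse S T) : IsSubuniverse S (pr12 T) := by
  intro o x hx
  choose c d h using hx
  exact ⟨_, _, hT o (fun i => ((x i).1, (x i).2, c i, d i)) h⟩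

theorem pr12_polyBridge {ρ τ : Set (A × A)} (hρ : IsCongruence S ρ) (hτ : τ ∈ Cov S ρ)
    {a b : A} (hab : (a, b) ∈ τ) (hab' : (a, b) ∉ ρ) (c d : A) :
    pr12 (polyBridge S ρ a b c d) = τ := by
  obtain ⟨hsub, hsat, hlt, hmin⟩ := hτ
  refine hmin _ (isSubuniverse_pr12 (isSubuniverse_polyBridge hρ a b c d)) ?_ ?_ ?_
  · refine saturated_of_stable hρ ?_
    rintro x y x' y' hx ⟨u, v, p, hp, h1, h2, h3, h4⟩ hy
    exact ⟨u, v, p, hp, hρ.2.trans h1 (hρ.2.symm hx), hρ.2.trans h2 hy, h3, h4⟩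
  · refine ⟨fun x hx => ⟨x.1, x.1, _, UnaryPoly.const x.1, hρ.2.refl _, hx, hρ.2.refl _,
      hρ.2.refl _⟩, fun h => hab' (h ?_)⟩
    exact ⟨c, d, _, UnaryPoly.id, hρ.2.refl _, hρ.2.refl _, hρ.2.refl _, hρ.2.refl _⟩
  · rintro ⟨x, y⟩ ⟨u, v, p, hp, h1, h2, -, -⟩
    exact hsat.mem (hρ.2.symm h1)
      (hp.mem_of_reflexive hsub (diag_mem_of_isCongruence_ssubset hρ hlt) hab) h2

theorem bConv_polyBridge (ρ : Set (A × A)) (a b c d : A) :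
    bConv (polyBridge S ρ a b c d) = polyBridge S ρ c d a b := by
  ext x
  constructor <;> rintro ⟨p, hp, h1, h2, h3, h4⟩ <;> exact ⟨p, hp, h3, h4, h1, h2⟩

theorem isBridgeLR_polyBridge {ρ τ τ' : Set (A × A)} (hρ : IsCongruence S ρ)
    (hτ : τ ∈ Cov S ρ) (hτ' : τ' ∈ Cov S ρ) {a b c d : A}
    (hab : (a, b) ∈ τ) (hab' : (a, b) ∉ ρ) (hcd : (c, d) ∈ τ') (hcd' : (c, d) ∉ ρ)
    (h : ∀ p : A → A, UnaryPoly S p → ((p a, p b) ∈ ρ ↔ (p c, p d) ∈ ρ)) :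
    IsBridgeLR S ρ ρ τ τ' (polyBridge S ρ a b c d) := by
  have hL := pr12_polyBridge hρ hτ hab hab' c d
  have hR : pr34 (polyBridge S ρ a b c d) = τ' := by
    rw [← pr12_polyBridge hρ hτ' hcd hcd' a b, ← bConv_polyBridge]
    rfl
  refine ⟨⟨isSubuniverse_polyBridge hρ a b c d, ?_, ?_, hL ▸ hτ.2.2.1, hR ▸ hτ'.2.2.1, ?_⟩,
    hL, hR⟩
  · rintro x y u v x' y' ⟨p, hp, h1, h2, h3, h4⟩ hx hy
    exact ⟨p, hp, hρ.2.trans h1 hx, hρ.2.trans h2 hy, h3, h4⟩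
  · rintro x y u v u' v' ⟨p, hp, h1, h2, h3, h4⟩ hu hv
    exact ⟨p, hp, h1, h2, hρ.2.trans h3 hu, hρ.2.trans h4 hv⟩
  · have hiff : ∀ {x y x' y' : A}, (x, x') ∈ ρ → (y, y') ∈ ρ → ((x', y') ∈ ρ ↔ (x, y) ∈ ρ) :=
      fun hx hy => ⟨fun hxy => hρ.2.trans hx (hρ.2.trans hxy (hρ.2.symm hy)),
        fun hxy => hρ.2.trans (hρ.2.symm hx) (hρ.2.trans hxy hy)⟩
    rintro x y u v ⟨p, hp, h1, h2, h3, h4⟩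
    exact (hiff h1 h2).trans ((h p hp).trans (hiff h3 h4).symm)

theorem reflBridge_polyBridge {ρ : Set (A × A)} (hρ : IsCongruence S ρ) (a b c d : A) :
    ReflBridge (polyBridge S ρ a b c d) :=
  fun e => ⟨_, UnaryPoly.const e, hρ.2.refl _, hρ.2.refl _, hρ.2.refl _, hρ.2.refl _⟩

theorem IsBridgeLR.bConv {B : Type} [SAlg S B] {ρ L : Set (A × A)} {σ R : Set (B × B)}
    {T : Set (A × A × B × B)} (h : IsBridgeLR S ρ σ L R T) :
    IsBridgeLR S σ ρ R L (bConv T) := by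
  obtain ⟨⟨h1, h2, h3, h4, h5, h6⟩, hL, hR⟩ := h
  refine ⟨⟨?_, ?_, ?_, h5, h4, ?_⟩, hR, hL⟩
  · exact fun o x hx => h1 o (fun i => ((x i).2.2.1, (x i).2.2.2, (x i).1, (x i).2.1)) hx
  · exact fun a₁ a₂ b₁ b₂ a₁' a₂' h => h3 b₁ b₂ a₁ a₂ a₁' a₂' h
  · exact fun a₁ a₂ b₁ b₂ b₁' b₂' h => h2 b₁ b₂ a₁ a₂ b₁' b₂' h
  · exact fun a₁ a₂ b₁ b₂ h => (h6 b₁ b₂ a₁ a₂ h).symm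

theorem IsBridgeLR.bComp {B C : Type} [SAlg S B] [SAlg S C] {ρ L : Set (A × A)}
    {σ M : Set (B × B)} {κ R : Set (C × C)} {T : Set (A × A × B × B)}
    {U : Set (B × B × C × C)} (hT : IsBridgeLR S ρ σ L M T) (hU : IsBridgeLR S σ κ M R U) :
    IsBridgeLR S ρ κ L R (bComp T U) := by
  obtain ⟨⟨t1, t2, -, t4, -, t6⟩, tL, tR⟩ := hT
  obtain ⟨⟨u1, -, u3, -, u5, u6⟩, uL, uR⟩ := hU
  have hL : pr12 (Zhuk.bComp T U) = L := by
    rw [← tL]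
    ext ⟨x, y⟩
    constructor
    · rintro ⟨_, _, b₁, b₂, hT, -⟩
      exact ⟨b₁, b₂, hT⟩
    · rintro ⟨b₁, b₂, hT⟩
      have hb : (b₁, b₂) ∈ pr12 U := by
        rw [uL, ← tR]
        exact ⟨x, y, hT⟩
      obtain ⟨c₁, c₂, hU⟩ := hb
      exact ⟨c₁, c₂, b₁, b₂, hT, hU⟩
  have hR : pr34 (Zhuk.bComp T U) = R := by
    rw [← uR]
    ext ⟨x, y⟩
    constructor
    · rintro ⟨_, _, b₁, b₂, -, hU⟩
      exact ⟨b₁, b₂, hU⟩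
    · rintro ⟨b₁, b₂, hU⟩
      have hb : (b₁, b₂) ∈ pr34 T := by
        rw [tR, ← uL]
        exact ⟨x, y, hU⟩
      obtain ⟨a₁, a₂, hT⟩ := hb
      exact ⟨a₁, a₂, b₁, b₂, hT, hU⟩
  refine ⟨⟨?_, ?_, ?_, ?_, ?_, ?_⟩, hL, hR⟩
  · intro o x hx
    choose b₁ b₂ hT hU using hx
    exact ⟨_, _, t1 o (fun i => ((x i).1, (x i).2.1, b₁ i, b₂ i)) hT,
      u1 o (fun i => (b₁ i, b₂ i, (x i).2.2.1, (x i).2.2.2)) hU⟩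
  · rintro a₁ a₂ c₁ c₂ a₁' a₂' ⟨b₁, b₂, hT, hU⟩ h h'
    exact ⟨b₁, b₂, t2 _ _ _ _ _ _ hT h h', hU⟩
  · rintro a₁ a₂ c₁ c₂ c₁' c₂' ⟨b₁, b₂, hT, hU⟩ h h'
    exact ⟨b₁, b₂, hT, u3 _ _ _ _ _ _ hU h h'⟩
  · rwa [hL, ← tL]
  · rwa [hR, ← uR]
  · rintro a₁ a₂ c₁ c₂ ⟨b₁, b₂, hT, hU⟩
    exact (t6 _ _ _ _ hT).trans (u6 _ _ _ _ hU)

/-- A reflexive bridge transports traces of reflexive bridges below maximal ones. -/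
theorem IsOptOf.refTr_subset {ρ L R γ δ : Set (A × A)} {T : Set (A × A × A × A)}
    (hγ : IsOptOf S ρ L γ) (hδ : δ ∈ refTr S ρ R) (hT : IsBridgeLR S ρ ρ L R T)
    (hrefl : ReflBridge T) : δ ⊆ γ := by
  obtain ⟨⟨U, hU, hUr, rfl⟩, hmax⟩ := hγ
  obtain ⟨V, hV, hVr, rfl⟩ := hδ
  let W := bComp U (bComp T (bComp V (bConv T)))
  have hW : IsBridgeLR S ρ ρ L L W := hU.bComp (hT.bComp (hV.bComp hT.bConv))
  have hmem : ∀ {a b c : A}, (a, b) ∈ btr U → (b, c) ∈ btr V → (a, c) ∈ btr W :=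
    fun {a b c} hab hbc => ⟨b, b, hab, b, b, hrefl b, c, c, hbc, hrefl c⟩
  rw [← hmax (btr W) ⟨W, hW, fun a => hmem (hUr a) (hVr a), rfl⟩
    fun x hx => hmem hx (hVr x.2)]
  exact fun x hx => hmem (hUr x.1) hx

end

end Zhuk

/-- for a meet-irreducible congruence of a finite Taylor algebra and
`τ, τ' ∈ Cov⁺(ρ)`, there is a reflexive bridge from `(A,ρ,τ)` to `(A,ρ,τ')`;
consequently `Opt(ρ,τ) = Opt(ρ,τ')`. -/
theorem stmt_7 {S : Zhuk.Signature} {A : Type} [Zhuk.SAlg S A] [Finite A]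
    (hTay : Zhuk.IsTaylorAlg S A)
    (ρ ρplus : Set (A × A)) (hmi : Zhuk.MeetIrredWith S ρ ρplus)
    (τ τ' : Set (A × A))
    (hτ : τ ∈ Zhuk.CovPlus S ρ ρplus) (hτ' : τ' ∈ Zhuk.CovPlus S ρ ρplus) :
    (∃ T : Set (A × A × A × A), Zhuk.IsBridgeLR S ρ ρ τ τ' T ∧ Zhuk.ReflBridge T) ∧
    (∀ γ γ' : Set (A × A), Zhuk.IsOptOf S ρ τ γ → Zhuk.IsOptOf S ρ τ' γ' → γ = γ') := by
  have hρ := hmi.1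
  obtain ⟨a, b, c, d, hab, hab', hcd, hcd', h⟩ :=
    Zhuk.exists_equicollapsed_pairs hmi hτ hτ'
  have hT := Zhuk.isBridgeLR_polyBridge hρ hτ.1 hτ'.1 hab hab' hcd hcd' h
  have hrefl := Zhuk.reflBridge_polyBridge hρ a b c d
  exact ⟨⟨_, hT, hrefl⟩, fun γ γ' hγ hγ' => Set.Subset.antisymm
    (hγ'.refTr_subset hγ.1 hT.bConv hrefl) (hγ.refTr_subset hγ'.1 hT hrefl)⟩
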